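/- arXiv:2103.10067 — 2 statements merged into one kernel-verified Lean document; each statement's English description precedes it below -/
import Mathlib

section
/- Let (𝔠ₖ)_{1≤k≤l} be an admissible chain of i-boxes of finite length l with range [a,b] (so l = b − a + 1). Then the number of indices s ∈ {1,…,l} such that 𝔠ₛ = [a(i)⁺, b(i)⁻] for some i ∈ I equals the number of distinct values of ι on [a,b]; that is, |{s : ∃ i ∈ I, 𝔠ₛ = [a(i)⁺, b(i)⁻]}| = |{ι(k) : a ≤ k ≤ b}|. -/
open Set

variable {I : Type*}

/-- Every fiber of `ι` is unbounded above and unbounded below. -/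
def FibersUnbounded (ι : ℤ → I) : Prop :=
  ∀ i : I, ∀ n : ℤ, (∃ k, n < k ∧ ι k = i) ∧ (∃ k, k < n ∧ ι k = i)

/-- `s⁺ = min {t | s < t, ι t = ι s}`. -/
noncomputable def splus (ι : ℤ → I) (s : ℤ) : ℤ := sInf {t : ℤ | s < t ∧ ι t = ι s}

/-- `s⁻ = max {t | t < s, ι t = ι s}`. -/
noncomputable def sminus (ι : ℤ → I) (s : ℤ) : ℤ := sSup {t : ℤ | t < s ∧ ι t = ι s}

/-- `s(j)⁺ = min {t | s ≤ t, ι t = j}`. -/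
noncomputable def jplus (ι : ℤ → I) (s : ℤ) (j : I) : ℤ := sInf {t : ℤ | s ≤ t ∧ ι t = j}

/-- `s(j)⁻ = max {t | t ≤ s, ι t = j}`. -/
noncomputable def jminus (ι : ℤ → I) (s : ℤ) (j : I) : ℤ := sSup {t : ℤ | t ≤ s ∧ ι t = j}

/-- `[a,b]` is an i-box: `a ≤ b` and `ι a = ι b`. -/
def IsIBox (ι : ℤ → I) (a b : ℤ) : Prop := a ≤ b ∧ ι a = ι b

/-- Two i-boxes `[a₁,b₁]` and `[a₂,b₂]` commute. -/
def BoxCommute (ι : ℤ → I) (a₁ b₁ a₂ b₂ : ℤ) : Prop :=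
  (sminus ι a₁ < a₂ ∧ a₂ ≤ b₂ ∧ b₂ < splus ι b₁) ∨
  (sminus ι a₂ < a₁ ∧ a₁ ≤ b₁ ∧ b₁ < splus ι b₂)

/-- The envelope set `𝔠̃ₖ = ⋃_{1 ≤ j ≤ k} [aⱼ,bⱼ]` of the first `k` boxes of a chain. -/
def envSet (a b : ℕ → ℤ) (k : ℕ) : Set ℤ := ⋃ j ∈ Set.Icc 1 k, Set.Icc (a j) (b j)

/-- `ãₖ`, the left endpoint of the envelope. -/
noncomputable def envA (a b : ℕ → ℤ) (k : ℕ) : ℤ := sInf (envSet a b k)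

/-- `b̃ₖ`, the right endpoint of the envelope. -/
noncomputable def envB (a b : ℕ → ℤ) (k : ℕ) : ℤ := sSup (envSet a b k)

/-- A chain of i-boxes `(𝔠ₖ = [a k, b k])_{1 ≤ k ≤ l}`, `l ∈ ℤ≥1 ∪ {∞}`, is admissible if
for every finite `k ≤ l` the envelope is an interval `[ãₖ, b̃ₖ]` with exactly `k` elements and
`𝔠ₖ = [ãₖ,b̃ₖ}` or `𝔠ₖ = {ãₖ,b̃ₖ]`. -/
def IsAdmissibleChain (ι : ℤ → I) (l : ℕ∞) (a b : ℕ → ℤ) : Prop :=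
  ∀ k : ℕ, 1 ≤ k → (k : ℕ∞) ≤ l →
    IsIBox ι (a k) (b k) ∧
    envSet a b k = Set.Icc (envA a b k) (envB a b k) ∧
    envB a b k + 1 = envA a b k + (k : ℤ) ∧
    ((a k = envA a b k ∧ b k = jminus ι (envB a b k) (ι (envA a b k))) ∨
     (a k = jplus ι (envA a b k) (ι (envB a b k)) ∧ b k = envB a b k))

/-- The range `⋃_{1 ≤ k ≤ l} 𝔠ₖ` of a chain. -/
def chainRange (l : ℕ∞) (a b : ℕ → ℤ) : Set ℤ :=
  ⋃ k ∈ {k : ℕ | 1 ≤ k ∧ (k : ℕ∞) ≤ l}, Set.Icc (a k) (b k)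

theorem jplus_isLeast {ι : ℤ → I} (hub : FibersUnbounded ι) (s : ℤ) (i : I) :
    IsLeast {t : ℤ | s ≤ t ∧ ι t = i} (jplus ι s i) := by
  obtain ⟨k, hk, hki⟩ := (hub i s).1
  have hb : BddBelow {t : ℤ | s ≤ t ∧ ι t = i} := ⟨s, fun t ht => ht.1⟩
  exact ⟨Int.csInf_mem ⟨k, hk.le, hki⟩ hb, fun t ht => csInf_le hb ht⟩

theorem jplus_self (ι : ℤ → I) (s : ℤ) : jplus ι s (ι s) = s :=
  IsLeast.csInf_eq ⟨⟨le_rfl, rfl⟩, fun _ ht => ht.1⟩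

theorem jminus_self (ι : ℤ → I) (s : ℤ) : jminus ι s (ι s) = s :=
  IsGreatest.csSup_eq ⟨⟨le_rfl, rfl⟩, fun _ ht => ht.1⟩

theorem jplus_add_one {ι : ℤ → I} {s : ℤ} {i : I} (h : ι s ≠ i) :
    jplus ι (s + 1) i = jplus ι s i := by
  unfold jplus
  congr 1
  ext t
  refine and_congr_left fun ht => ⟨fun hs => by omega, fun hs => ?_⟩
  have : s ≠ t := by rintro rfl; exact h ht
  omega

theorem jminus_add_one {ι : ℤ → I} {s : ℤ} {i : I} (h : ι (s + 1) ≠ i) :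
    jminus ι (s + 1) i = jminus ι s i := by
  unfold jminus
  congr 1
  ext t
  refine and_congr_left fun ht => ⟨fun hs => ?_, fun hs => by omega⟩
  have : s + 1 ≠ t := by rintro rfl; exact h ht
  omega

theorem envSet_succ (a b : ℕ → ℤ) (k : ℕ) :
    envSet a b (k + 1) = envSet a b k ∪ Set.Icc (a (k + 1)) (b (k + 1)) := by
  rw [envSet, ← Set.insert_Icc_right_eq_Icc_add_one (by omega), Set.biUnion_insert, Set.union_comm,
    envSet]

theorem Icc_subset_envSet {a b : ℕ → ℤ} {j k : ℕ} (hj : 1 ≤ j) (hjk : j ≤ k) :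
    Set.Icc (a j) (b j) ⊆ envSet a b k :=
  Set.subset_biUnion_of_mem (u := fun j => Set.Icc (a j) (b j)) (Set.mem_Icc.2 ⟨hj, hjk⟩)

namespace IsAdmissibleChain

variable {ι : ℤ → I} {l : ℕ∞} {a b : ℕ → ℤ}

theorem mem_envelope (h : IsAdmissibleChain ι l a b) {s k : ℕ} (hs : 1 ≤ s) (hsk : s ≤ k)
    (hk : (k : ℕ∞) ≤ l) :
    a s ∈ Set.Icc (envA a b k) (envB a b k) ∧ b s ∈ Set.Icc (envA a b k) (envB a b k) := by
  have hsl : (s : ℕ∞) ≤ l := le_trans (by exact_mod_cast hsk) hk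
  rw [← (h k (hs.trans hsk) hk).2.1]
  exact ⟨Icc_subset_envSet hs hsk ⟨le_rfl, (h s hs hsl).1.1⟩,
    Icc_subset_envSet hs hsk ⟨(h s hs hsl).1.1, le_rfl⟩⟩

/-- Every box is the largest box of its color inside its envelope. -/
theorem eq_jplus_jminus (h : IsAdmissibleChain ι l a b) {k : ℕ} (hk : 1 ≤ k)
    (hkl : (k : ℕ∞) ≤ l) :
    a k = jplus ι (envA a b k) (ι (a k)) ∧ b k = jminus ι (envB a b k) (ι (a k)) := by
  obtain ⟨⟨-, hab⟩, -, -, ⟨h₁, h₂⟩ | ⟨h₁, h₂⟩⟩ := h k hk hkl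
  · rw [h₁, jplus_self]
    exact ⟨rfl, h₂⟩
  · rw [hab, h₂, jminus_self]
    exact ⟨h₁, rfl⟩

/-- Each step extends the envelope by one element, which is an endpoint of the new box. -/
theorem envelope_succ (h : IsAdmissibleChain ι l a b) {k : ℕ} (hk : 1 ≤ k)
    (hkl : ((k + 1 : ℕ) : ℕ∞) ≤ l) :
    (envA a b k = envA a b (k + 1) + 1 ∧ envB a b (k + 1) = envB a b k ∧
      a (k + 1) = envA a b (k + 1)) ∨
    (envB a b (k + 1) = envB a b k + 1 ∧ envA a b k = envA a b (k + 1) ∧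
      b (k + 1) = envB a b (k + 1)) := by
  have hkl' : (k : ℕ∞) ≤ l := le_trans (by exact_mod_cast k.le_succ) hkl
  obtain ⟨-, hE, hc, -⟩ := h k hk hkl'
  obtain ⟨-, hE', hc', -⟩ := h (k + 1) (by omega) hkl
  obtain ⟨ha, hb⟩ := h.mem_envelope (Nat.le_add_left 1 k) le_rfl hkl
  have hU := envSet_succ a b k
  rw [hE, hE'] at hU
  have hmem (t : ℤ) := Set.ext_iff.1 hU t
  simp only [Set.mem_union, Set.mem_Icc] at hmem ha hb
  have h₁ := hmem (envA a b k)
  have h₂ := hmem (envB a b k)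
  have h₃ := hmem (envA a b (k + 1))
  have h₄ := hmem (envB a b (k + 1))
  omega

theorem le_of_eq_box (h : IsAdmissibleChain ι l a b) {s t : ℕ} (hs : 1 ≤ s)
    (ht : (t : ℕ∞) ≤ l) (ha : a s = a t) (hb : b s = b t) : t ≤ s := by
  by_contra! hst
  obtain ⟨k, rfl⟩ : ∃ k, t = k + 1 := ⟨t - 1, by omega⟩
  have hk : (k : ℕ∞) ≤ l := le_trans (by exact_mod_cast k.le_succ) ht
  have hm := h.mem_envelope hs (by omega : s ≤ k) hk
  have hsucc := h.envelope_succ (by omega) ht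
  simp only [Set.mem_Icc] at hm
  omega

/-- Every color in an envelope is attained by a box that is the largest of its color in it. -/
theorem exists_box (h : IsAdmissibleChain ι l a b) {k : ℕ} (hk : 1 ≤ k) :
    (k : ℕ∞) ≤ l → ∀ i ∈ ι '' Set.Icc (envA a b k) (envB a b k),
      ∃ s, 1 ≤ s ∧ s ≤ k ∧ ι (a s) = i ∧
        a s = jplus ι (envA a b k) i ∧ b s = jminus ι (envB a b k) i := by
  induction k, hk using Nat.le_induction with
  | base =>
    rintro hl _ ⟨t, ht, rfl⟩
    have hm := (h.mem_envelope le_rfl le_rfl hl).1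
    have hc := (h 1 le_rfl hl).2.2.1
    simp only [Set.mem_Icc] at hm ht
    obtain rfl : t = a 1 := by omega
    exact ⟨1, le_rfl, le_rfl, rfl, h.eq_jplus_jminus le_rfl hl⟩
  | succ k hk ih =>
    rintro hl _ ⟨t, ht, rfl⟩
    have hkl : (k : ℕ∞) ≤ l := le_trans (by exact_mod_cast k.le_succ) hl
    by_cases hi : ι (a (k + 1)) = ι t
    · exact ⟨k + 1, by omega, le_rfl, hi, hi ▸ h.eq_jplus_jminus (by omega) hl⟩
    rw [Set.mem_Icc] at ht
    rcases h.envelope_succ hk hl with ⟨h₁, h₂, h₃⟩ | ⟨h₁, h₂, h₃⟩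
    · rw [h₃] at hi
      have hne : t ≠ envA a b (k + 1) := by rintro rfl; exact hi rfl
      obtain ⟨s, hs, hsk, hsi, has, hbs⟩ := ih hkl (ι t) ⟨t, ⟨by omega, by omega⟩, rfl⟩
      rw [h₁, jplus_add_one hi] at has
      exact ⟨s, hs, by omega, hsi, has, h₂ ▸ hbs⟩
    · rw [(h (k + 1) (by omega) hl).1.2, h₃] at hi
      have hne : t ≠ envB a b (k + 1) := by rintro rfl; exact hi rfl
      obtain ⟨s, hs, hsk, hsi, has, hbs⟩ := ih hkl (ι t) ⟨t, ⟨by omega, by omega⟩, rfl⟩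
      rw [h₁] at hi ⊢
      rw [jminus_add_one hi]
      exact ⟨s, hs, by omega, hsi, h₂ ▸ has, hbs⟩

end IsAdmissibleChain

theorem stmt11 (ι : ℤ → I) (hub : FibersUnbounded ι)
    (l : ℕ) (hl : 1 ≤ l) (a b : ℕ → ℤ) (h : IsAdmissibleChain ι (l : ℕ∞) a b)
    (x y : ℤ) (hx : envA a b l = x) (hy : envB a b l = y) :
    {s : ℕ | 1 ≤ s ∧ s ≤ l ∧ ∃ i : I, a s = jplus ι x i ∧ b s = jminus ι y i}.ncard
      = (ι '' Set.Icc x y).ncard := by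
  subst hx hy
  refine Set.ncard_congr (fun s _ => ι (a s)) ?_ ?_ ?_
  · rintro s ⟨hs, hsl, -⟩
    exact ⟨a s, (h.mem_envelope hs hsl le_rfl).1, rfl⟩
  · rintro s t ⟨hs, hsl, i, has, hbs⟩ ⟨ht, htl, j, hat, hbt⟩ hst
    obtain rfl : i = j := by
      rwa [has, hat, (jplus_isLeast hub _ i).1.2, (jplus_isLeast hub _ j).1.2] at hst
    have ha : a s = a t := has.trans hat.symm
    have hb : b s = b t := hbs.trans hbt.symm
    exact le_antisymm (h.le_of_eq_box ht (by exact_mod_cast hsl) ha.symm hb.symm)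
      (h.le_of_eq_box hs (by exact_mod_cast htl) ha hb)
  · intro i hi
    obtain ⟨s, hs, hsl, hsi, has, hbs⟩ := h.exists_box hl le_rfl i hi
    exact ⟨s, ⟨hs, hsl, i, has, hbs⟩, hsi⟩
end

section
/- Fix s ∈ ℤ, write i := ι(s), and let a ≤ b be integers with a ≤ s⁻ < s ≤ b. Then the following two set identities hold: (1) {t ∈ ℤ : ι(t) ∼ i and t⁻ < s⁻ < t < s} = {s⁻(j)⁺ : j ∈ I, j ∼ i, s⁻ < s(j)⁻}; (2) {t ∈ ℤ : t ≤ b, ι(t) ∼ i and s⁻ < t⁻ < s < t} = {s(j)⁺ : j ∈ I, j ∼ i, s⁻ < s(j)⁻, s(j)⁺ ≤ b}. -/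
open Set

variable {I : Type*}

theorem isGreatest_sminus {ι : ℤ → I} (hub : FibersUnbounded ι) (s : ℤ) :
    IsGreatest {t : ℤ | t < s ∧ ι t = ι s} (sminus ι s) := by
  have hbdd : BddAbove {t : ℤ | t < s ∧ ι t = ι s} := ⟨s, fun _ h => h.1.le⟩
  exact ⟨Int.csSup_mem (hub (ι s) s).2 hbdd, fun _ h => le_csSup hbdd h⟩

theorem isLeast_jplus {ι : ℤ → I} (hub : FibersUnbounded ι) (s : ℤ) (j : I) :
    IsLeast {t : ℤ | s ≤ t ∧ ι t = j} (jplus ι s j) := by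
  have hbdd : BddBelow {t : ℤ | s ≤ t ∧ ι t = j} := ⟨s, fun _ h => h.1⟩
  obtain ⟨k, hk, hkj⟩ := (hub j s).1
  exact ⟨Int.csInf_mem ⟨k, hk.le, hkj⟩ hbdd, fun _ h => csInf_le hbdd h⟩

theorem isGreatest_jminus {ι : ℤ → I} (hub : FibersUnbounded ι) (s : ℤ) (j : I) :
    IsGreatest {t : ℤ | t ≤ s ∧ ι t = j} (jminus ι s j) := by
  have hbdd : BddAbove {t : ℤ | t ≤ s ∧ ι t = j} := ⟨s, fun _ h => h.1⟩
  obtain ⟨k, hk, hkj⟩ := (hub j s).2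
  exact ⟨Int.csSup_mem ⟨k, hk.le, hkj⟩ hbdd, fun _ h => le_csSup hbdd h⟩

/-- If `t⁻ < s ≤ t`, then `t` is the first occurrence of its color from `s` on. -/
theorem jplus_eq_of_sminus_lt {ι : ℤ → I} (hub : FibersUnbounded ι) {s t : ℤ}
    (hts : sminus ι t < s) (hst : s ≤ t) : jplus ι s (ι t) = t := by
  refine (isLeast_jplus hub s (ι t)).unique ⟨⟨hst, rfl⟩, fun x hx => ?_⟩
  by_contra! hxt
  exact absurd ((isGreatest_sminus hub t).2 ⟨hxt, hx.2⟩) (not_le.2 (hts.trans_le hx.1))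

theorem sminus_jplus_lt {ι : ℤ → I} (hub : FibersUnbounded ι) (s : ℤ) (j : I) :
    sminus ι (jplus ι s j) < s := by
  obtain ⟨hlt, hcol⟩ := (isGreatest_sminus hub (jplus ι s j)).1
  obtain ⟨⟨_, hj⟩, hmin⟩ := isLeast_jplus hub s j
  by_contra! h
  exact absurd (hmin ⟨h, hcol.trans hj⟩) (not_le.2 hlt)

theorem stmt19 (Δ : SimpleGraph I) (ι : ℤ → I) (hub : FibersUnbounded ι)
    (s a b : ℤ) (hab : a ≤ b) (ha : a ≤ sminus ι s) (hb : s ≤ b) :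
    ({t : ℤ | Δ.Adj (ι t) (ι s) ∧ sminus ι t < sminus ι s ∧ sminus ι s < t ∧ t < s} =
      {x : ℤ | ∃ j : I, Δ.Adj j (ι s) ∧ sminus ι s < jminus ι s j ∧
        x = jplus ι (sminus ι s) j}) ∧
    ({t : ℤ | t ≤ b ∧ Δ.Adj (ι t) (ι s) ∧ sminus ι s < sminus ι t ∧ sminus ι t < s ∧ s < t} =
      {x : ℤ | ∃ j : I, Δ.Adj j (ι s) ∧ sminus ι s < jminus ι s j ∧ jplus ι s j ≤ b ∧
        x = jplus ι s j}) := by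
  obtain ⟨hs_lt, hs_col⟩ := (isGreatest_sminus hub s).1
  constructor
  · ext t
    constructor
    · rintro ⟨hadj, h₁, h₂, h₃⟩
      exact ⟨ι t, hadj, h₂.trans_le ((isGreatest_jminus hub s (ι t)).2 ⟨h₃.le, rfl⟩),
        (jplus_eq_of_sminus_lt hub h₁ h₂.le).symm⟩
    · rintro ⟨j, hadj, hm, rfl⟩
      obtain ⟨⟨hle, hj⟩, hmin⟩ := isLeast_jplus hub (sminus ι s) j
      obtain ⟨hms, hmj⟩ := (isGreatest_jminus hub s j).1
      refine ⟨hj.symm ▸ hadj, sminus_jplus_lt hub _ j, lt_of_le_of_ne hle fun h => ?_,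
        lt_of_le_of_ne ((hmin ⟨hm.le, hmj⟩).trans hms) fun h => ?_⟩
      · exact hadj.ne (by rw [← hj, ← h, hs_col])
      · exact hadj.ne (by rw [← hj, h])
  · ext t
    constructor
    · rintro ⟨htb, hadj, h₁, h₂, h₃⟩
      have heq := jplus_eq_of_sminus_lt hub h₂ h₃.le
      exact ⟨ι t, hadj, h₁.trans_le ((isGreatest_jminus hub s (ι t)).2
        ⟨h₂.le, (isGreatest_sminus hub t).1.2⟩), heq.le.trans htb, heq.symm⟩
    · rintro ⟨j, hadj, hm, hjb, rfl⟩
      obtain ⟨hle, hj⟩ := (isLeast_jplus hub s j).1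
      obtain ⟨hms, hmj⟩ := (isGreatest_jminus hub s j).1
      have hlt : s < jplus ι s j :=
        lt_of_le_of_ne hle fun h => hadj.ne (by rw [← hj, ← h])
      exact ⟨hjb, hj.symm ▸ hadj, hm.trans_le ((isGreatest_sminus hub _).2
        ⟨hms.trans_lt hlt, hmj.trans hj.symm⟩), sminus_jplus_lt hub s j, hlt⟩
end
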